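/- Fix c with 0 < c < 1. The function z ↦ inf { Λ_μ(z) : μ ∈ BMS(c) } is nonincreasing and concave on [0,1]. (Hence the pointwise infimum Λ̲ is itself the Λ-function of a BMS channel, and the least upgraded channel with respect to the family BMS(c) satisfies Λ_* = Λ̲.) -/

import Mathlib

open MeasureTheory Real Set

/-- Binary entropy function (Lean's `logb` satisfies `logb 2 0 = 0`,
so the convention `0·log₂ 0 = 0` is automatic). -/
noncomputable def h2 (p : ℝ) : ℝ := -p * Real.logb 2 p - (1 - p) * Real.logb 2 (1 - p)

/-- `h(x) = h₂((1-x)/2)`. -/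
noncomputable def hD (x : ℝ) : ℝ := h2 ((1 - x) / 2)

/-- `Λ_μ(z) = ∫ (1 - max(z,x)) dμ(x)`. -/
noncomputable def Lam (μ : Measure ℝ) (z : ℝ) : ℝ := ∫ x, (1 - max z x) ∂μ

/-- A pointwise infimum of antitone functions, bounded below at each point, is antitone. -/
theorem antitoneOn_sInf_image {α : Type*} {M : Set α} {f : α → ℝ → ℝ} {s : Set ℝ}
    (hbdd : ∀ z ∈ s, BddBelow ((fun a => f a z) '' M)) (hf : ∀ a ∈ M, AntitoneOn (f a) s) :
    AntitoneOn (fun z => sInf ((fun a => f a z) '' M)) s := by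
  rcases M.eq_empty_or_nonempty with rfl | hM
  · simpa using antitoneOn_const
  intro x hx y hy hxy
  refine le_csInf (hM.image _) ?_
  rintro _ ⟨a, ha, rfl⟩
  exact (csInf_le (hbdd y hy) ⟨a, ha, rfl⟩).trans (hf a ha hx hy hxy)

/-- A pointwise infimum of concave functions, bounded below at each point, is concave. -/
theorem concaveOn_sInf_image {α : Type*} {M : Set α} {f : α → ℝ → ℝ} {s : Set ℝ}
    (hs : Convex ℝ s) (hbdd : ∀ z ∈ s, BddBelow ((fun a => f a z) '' M))
    (hf : ∀ a ∈ M, ConcaveOn ℝ s (f a)) :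
    ConcaveOn ℝ s (fun z => sInf ((fun a => f a z) '' M)) := by
  rcases M.eq_empty_or_nonempty with rfl | hM
  · simpa using concaveOn_const 0 hs
  refine ⟨hs, fun x hx y hy a b ha hb hab => le_csInf (hM.image _) ?_⟩
  rintro _ ⟨m, hm, rfl⟩
  refine le_trans ?_ ((hf m hm).2 hx hy ha hb hab)
  have h₁ := csInf_le (hbdd x hx) ⟨m, hm, rfl⟩
  have h₂ := csInf_le (hbdd y hy) ⟨m, hm, rfl⟩
  simp only [smul_eq_mul]
  gcongr

section Lam

variable {μ : Measure ℝ}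

theorem integrable_one_sub_max [IsFiniteMeasure μ] (hμ : μ (Icc (0 : ℝ) 1)ᶜ = 0) (z : ℝ) :
    Integrable (fun x => 1 - max z x) μ := by
  refine Integrable.of_bound (C := 1 + max |z| 1)
    (by fun_prop : Measurable fun x : ℝ => 1 - max z x).aestronglyMeasurable ?_
  have hμ' : ∀ᵐ x ∂μ, x ∈ Icc (0 : ℝ) 1 := hμ
  filter_upwards [hμ'] with x hx
  calc ‖1 - max z x‖ ≤ ‖(1 : ℝ)‖ + ‖max z x‖ := norm_sub_le _ _
    _ ≤ 1 + max |z| 1 := by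
      rw [norm_one, Real.norm_eq_abs]
      gcongr
      refine abs_max_le_max_abs_abs.trans (max_le_max le_rfl ?_)
      rw [abs_of_nonneg hx.1]
      exact hx.2

theorem Lam_nonneg (hμ : μ (Icc (0 : ℝ) 1)ᶜ = 0) {z : ℝ} (hz : z ≤ 1) : 0 ≤ Lam μ z := by
  refine integral_nonneg_of_ae ?_
  have hμ' : ∀ᵐ x ∂μ, x ∈ Icc (0 : ℝ) 1 := hμ
  filter_upwards [hμ'] with x hx
  exact sub_nonneg.2 (max_le hz hx.2)

theorem Lam_antitone [IsFiniteMeasure μ] (hμ : μ (Icc (0 : ℝ) 1)ᶜ = 0) : Antitone (Lam μ) :=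
  fun x y hxy => integral_mono (integrable_one_sub_max hμ y) (integrable_one_sub_max hμ x)
    fun _ => sub_le_sub_left (max_le_max_right _ hxy) 1

theorem concaveOn_Lam [IsFiniteMeasure μ] (hμ : μ (Icc (0 : ℝ) 1)ᶜ = 0) :
    ConcaveOn ℝ univ (Lam μ) := by
  refine ⟨convex_univ, fun x _ y _ a b ha hb hab => ?_⟩
  have hx := (integrable_one_sub_max hμ x).const_mul a
  have hy := (integrable_one_sub_max hμ y).const_mul b
  simp only [Lam, smul_eq_mul]
  rw [← integral_const_mul, ← integral_const_mul, ← integral_add hx hy]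
  refine integral_mono (hx.add hy) (integrable_one_sub_max hμ _) fun t => ?_
  have hmax : max (a * x + b * y) t ≤ a * max x t + b * max y t := by
    refine max_le (by gcongr <;> exact le_max_left _ _) ?_
    calc t = a * t + b * t := by rw [← add_mul, hab, one_mul]
      _ ≤ _ := by gcongr <;> exact le_max_right _ _
  change a * (1 - max x t) + b * (1 - max y t) ≤ 1 - max (a * x + b * y) t
  linarith

end Lam

/-- The pointwise infimum `Λ̲(z) = inf { Λ_μ(z) : μ ∈ BMS(c) }` is
nonincreasing and concave on `[0,1]` (hence it is itself the Λ-function of a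
BMS channel, the least upgraded channel `Λ_* = Λ̲`). -/
theorem Lam_inf_antitone_concave
    (c : ℝ) (hc0 : 0 < c) (hc1 : c < 1) :
    AntitoneOn
      (fun z : ℝ => sInf {r : ℝ | ∃ μ : Measure ℝ,
        IsProbabilityMeasure μ ∧ μ (Set.Icc (0:ℝ) 1)ᶜ = 0 ∧
        (∫ x, hD x ∂μ) = 1 - c ∧ Lam μ z = r})
      (Set.Icc (0:ℝ) 1) ∧
    ConcaveOn ℝ (Set.Icc (0:ℝ) 1)
      (fun z : ℝ => sInf {r : ℝ | ∃ μ : Measure ℝ,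
        IsProbabilityMeasure μ ∧ μ (Set.Icc (0:ℝ) 1)ᶜ = 0 ∧
        (∫ x, hD x ∂μ) = 1 - c ∧ Lam μ z = r}) := by
  have hset : ∀ z : ℝ, {r : ℝ | ∃ μ : Measure ℝ, IsProbabilityMeasure μ ∧
      μ (Set.Icc (0:ℝ) 1)ᶜ = 0 ∧ (∫ x, hD x ∂μ) = 1 - c ∧ Lam μ z = r} =
      (fun μ => Lam μ z) '' {μ : Measure ℝ | IsProbabilityMeasure μ ∧
        μ (Set.Icc (0:ℝ) 1)ᶜ = 0 ∧ (∫ x, hD x ∂μ) = 1 - c} := fun z => by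
    ext r
    simp only [mem_ofPred_eq, mem_image, and_assoc]
  simp only [hset]
  have hbdd : ∀ z ∈ Icc (0 : ℝ) 1, BddBelow ((fun μ => Lam μ z) '' {μ : Measure ℝ |
      IsProbabilityMeasure μ ∧ μ (Set.Icc (0:ℝ) 1)ᶜ = 0 ∧ (∫ x, hD x ∂μ) = 1 - c}) := by
    refine fun z hz => ⟨0, ?_⟩
    rintro _ ⟨μ, ⟨-, hμ, -⟩, rfl⟩
    exact Lam_nonneg hμ hz.2
  refine ⟨antitoneOn_sInf_image hbdd ?_, concaveOn_sInf_image (convex_Icc 0 1) hbdd ?_⟩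
  · rintro μ ⟨_, hμ, -⟩
    exact (Lam_antitone hμ).antitoneOn _
  · rintro μ ⟨_, hμ, -⟩
    exact (concaveOn_Lam hμ).subset (subset_univ _) (convex_Icc 0 1)
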